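/- There does not exist a pair (b, s) ∈ F(d) such that (i) R1(b, s; γ) ≤ 0 for all γ ∈ ℝ, (ii) R2(b, s; γ) ≤ 0 for all γ ∈ ℝ, and (iii) strict inequality holds in (i) or (ii) for at least one γ ∈ ℝ. (This is the reduced form of Theorem 1: in the linear regression model, R1(b,s;γ) is the excess of the expected length of the confidence interval J(b,s) over that of the usual interval I, scaled by the expected length of I, and −R2(b,s;γ) is the excess of the coverage probability of J(b,s) over that of I; hence the usual interval I is strongly admissible within the class D.) -/

import Mathlib

open MeasureTheory Set

/-- Standard normal density. -/
noncomputable def phi (x : ℝ) : ℝ := (Real.sqrt (2 * Real.pi))⁻¹ * Real.exp (-(x ^ 2) / 2)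

/-- Standard normal cumulative distribution function. -/
noncomputable def Phi (x : ℝ) : ℝ := ∫ u in Set.Iic x, phi u

/-- `Psi x y μ v = P(x ≤ Z ≤ y)` for `Z ~ N(μ, v)`. -/
noncomputable def Psi (x y μ v : ℝ) : ℝ :=
  ∫ z in Set.Icc x y, (Real.sqrt (2 * Real.pi * v))⁻¹ * Real.exp (-((z - μ) ^ 2) / (2 * v))

/-- Density of `W = √(Q/m)` where `Q ~ χ²_m`. -/
noncomputable def fW (m : ℕ) (w : ℝ) : ℝ :=
  if 0 < w then
    (2 * ((m : ℝ) / 2) ^ ((m : ℝ) / 2) / Real.Gamma ((m : ℝ) / 2)) * w ^ ((m : ℝ) - 1) *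
      Real.exp (-(m : ℝ) * w ^ 2 / 2)
  else 0

/-- `E(W) = ∫₀^∞ w f_W(w) dw`. -/
noncomputable def EW (m : ℕ) : ℝ := ∫ w in Set.Ioi (0 : ℝ), w * fW m w

/-- The class `F(d)` of pairs `(b, s)`: `b : ℝ → ℝ` odd and bounded, `s : [0,∞) → (0,∞)`
bounded, both continuous except possibly at finitely many points, with `b(x) = 0` for
`|x| ≥ d` and `s(x) = t` for `x ≥ d`. -/
structure MemF (d t : ℝ) (b s : ℝ → ℝ) : Prop where
  b_odd : ∀ x, b (-x) = -b x
  b_bdd : ∃ M : ℝ, ∀ x, |b x| ≤ M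
  s_pos : ∀ x, 0 ≤ x → 0 < s x
  s_bdd : ∃ M : ℝ, ∀ x, 0 ≤ x → s x ≤ M
  b_cont : ∃ S : Finset ℝ, ∀ x ∉ S, ContinuousAt b x
  s_cont : ∃ S : Finset ℝ, ∀ x, 0 ≤ x → x ∉ S → ContinuousAt s x
  b_zero : ∀ x, d ≤ |x| → b x = 0
  s_eq_t : ∀ x, d ≤ x → s x = t

/-- Scaled expected-length excess `R1(b,s;γ)` (it depends on `(b,s)` only through `s`). -/
noncomputable def R1 (m : ℕ) (t d : ℝ) (s : ℝ → ℝ) (γ : ℝ) : ℝ :=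
  (1 / (t * EW m)) *
    ∫ w in Set.Ioi (0 : ℝ),
      (∫ x in (-d)..d, (s |x| - t) * phi (w * x - γ)) * (w ^ 2 * fW m w)

/-- `k†(h, w, γ) = Ψ(−tw, tw; ρ(h−γ), 1−ρ²)`. -/
noncomputable def kdag (t ρ h w γ : ℝ) : ℝ :=
  Psi (-(t * w)) (t * w) (ρ * (h - γ)) (1 - ρ ^ 2)

/-- `k(h, w, γ) = Ψ(b(h/w)w − s(|h|/w)w, b(h/w)w + s(|h|/w)w; ρ(h−γ), 1−ρ²)`. -/
noncomputable def kfun (b s : ℝ → ℝ) (ρ h w γ : ℝ) : ℝ :=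
  Psi (b (h / w) * w - s (|h| / w) * w) (b (h / w) * w + s (|h| / w) * w)
    (ρ * (h - γ)) (1 - ρ ^ 2)

/-- Minus the coverage-probability excess, `R2(b,s;γ)`. -/
noncomputable def R2 (m : ℕ) (t d ρ : ℝ) (b s : ℝ → ℝ) (γ : ℝ) : ℝ :=
  -∫ w in Set.Ioi (0 : ℝ),
      (∫ x in (-d)..d, (kfun b s ρ (w * x) w γ - kdag t ρ (w * x) w γ) * phi (w * x - γ)) *
        (w * fW m w)

lemma phi_eq_gaussianPDFReal (x : ℝ) : phi x = ProbabilityTheory.gaussianPDFReal 0 1 x := by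
  simp [phi, ProbabilityTheory.gaussianPDFReal]

lemma phi_pos (x : ℝ) : 0 < phi x := by
  unfold phi; positivity

lemma continuous_phi : Continuous phi := by
  unfold phi; fun_prop

lemma integrable_phi : Integrable phi := by
  rw [funext phi_eq_gaussianPDFReal]
  exact ProbabilityTheory.integrable_gaussianPDFReal 0 1

lemma integral_phi : ∫ x, phi x = 1 := by
  simp_rw [phi_eq_gaussianPDFReal]
  exact ProbabilityTheory.integral_gaussianPDFReal_eq_one 0 one_ne_zero

lemma phi_le_phi_iff {x y : ℝ} : phi x ≤ phi y ↔ |y| ≤ |x| := by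
  have h : 0 < (Real.sqrt (2 * Real.pi))⁻¹ := by positivity
  rw [phi, phi, mul_le_mul_iff_right₀ h, Real.exp_le_exp, ← sq_le_sq]
  constructor <;> intro h <;> linarith

lemma normal_density_eq_gaussianPDFReal {v : ℝ} (hv : 0 < v) (μ z : ℝ) :
    (Real.sqrt (2 * Real.pi * v))⁻¹ * Real.exp (-((z - μ) ^ 2) / (2 * v)) =
      ProbabilityTheory.gaussianPDFReal μ v.toNNReal z := by
  simp [ProbabilityTheory.gaussianPDFReal, hv.le]

lemma integrable_normal_density {v : ℝ} (hv : 0 < v) (μ : ℝ) :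
    Integrable fun z : ℝ ↦
      (Real.sqrt (2 * Real.pi * v))⁻¹ * Real.exp (-((z - μ) ^ 2) / (2 * v)) := by
  simp_rw [normal_density_eq_gaussianPDFReal hv]
  exact ProbabilityTheory.integrable_gaussianPDFReal _ _

lemma integral_normal_density {v : ℝ} (hv : 0 < v) (μ : ℝ) :
    ∫ z, (Real.sqrt (2 * Real.pi * v))⁻¹ * Real.exp (-((z - μ) ^ 2) / (2 * v)) = 1 := by
  simp_rw [normal_density_eq_gaussianPDFReal hv]
  exact ProbabilityTheory.integral_gaussianPDFReal_eq_one _ (by simpa using hv)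

lemma Psi_nonneg (x y μ v : ℝ) : 0 ≤ Psi x y μ v :=
  integral_nonneg fun z ↦ by positivity

lemma Psi_le_one (x y μ : ℝ) {v : ℝ} (hv : 0 < v) : Psi x y μ v ≤ 1 := by
  rw [← integral_normal_density hv μ]
  exact setIntegral_le_integral (integrable_normal_density hv μ)
    (Filter.Eventually.of_forall fun z ↦ by positivity)

lemma Psi_standard (x y : ℝ) : Psi x y 0 1 = ∫ z in Icc x y, phi z := by
  simp [Psi, phi]

lemma measurable_Psi {α : Type*} [MeasurableSpace α] {f g h : α → ℝ} (hf : Measurable f)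
    (hg : Measurable g) (hh : Measurable h) (v : ℝ) :
    Measurable fun a ↦ Psi (f a) (g a) (h a) v := by
  have key : Measurable fun p : α × ℝ ↦ (Icc (f p.1) (g p.1)).indicator
      (fun z ↦ (Real.sqrt (2 * Real.pi * v))⁻¹ * Real.exp (-((z - h p.1) ^ 2) / (2 * v))) p.2 := by
    simp only [indicator, mem_Icc]
    refine Measurable.ite ?_ (by fun_prop) measurable_const
    exact (measurableSet_le (hf.comp measurable_fst) measurable_snd).inter
      (measurableSet_le measurable_snd (hg.comp measurable_fst))
  have := key.stronglyMeasurable.integral_prod_right' (ν := volume)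
  simpa only [Psi, ← integral_indicator measurableSet_Icc] using this.measurable

/-- Averaging the conditional law `N(ρu, 1 - ρ²)` over `u ~ N(0, 1)` gives `N(0, 1)`. -/
lemma integral_Psi_mul_phi {ρ : ℝ} (hρ : 0 < 1 - ρ ^ 2) (x y : ℝ) :
    ∫ u, Psi x y (ρ * u) (1 - ρ ^ 2) * phi u = Psi x y 0 1 := by
  set c := (Real.sqrt (2 * Real.pi * (1 - ρ ^ 2)))⁻¹ with hc
  have hsq : ∀ u z : ℝ, c * Real.exp (-((z - ρ * u) ^ 2) / (2 * (1 - ρ ^ 2))) * phi u =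
      phi z * (c * Real.exp (-((u - ρ * z) ^ 2) / (2 * (1 - ρ ^ 2)))) := by
    intro u z
    have : Real.exp (-((z - ρ * u) ^ 2) / (2 * (1 - ρ ^ 2))) * Real.exp (-(u ^ 2) / 2) =
        Real.exp (-(z ^ 2) / 2) * Real.exp (-((u - ρ * z) ^ 2) / (2 * (1 - ρ ^ 2))) := by
      rw [← Real.exp_add, ← Real.exp_add]
      congr 1
      field_simp
      ring
    unfold phi
    linear_combination c * (Real.sqrt (2 * Real.pi))⁻¹ * this
  have hint : Integrable (Function.uncurry fun u z : ℝ ↦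
      c * Real.exp (-((z - ρ * u) ^ 2) / (2 * (1 - ρ ^ 2))) * phi u)
      (volume.prod (volume.restrict (Icc x y))) := by
    refine (integrable_phi.comp_fst (volume.restrict (Icc x y))).bdd_mul (c := c)
      (by fun_prop) (Filter.Eventually.of_forall fun p ↦ ?_)
    have hc0 : 0 ≤ c := by positivity
    rw [norm_mul, Real.norm_of_nonneg hc0, Real.norm_of_nonneg (Real.exp_pos _).le]
    refine mul_le_of_le_one_right hc0 (Real.exp_le_one_iff.2 ?_)
    exact div_nonpos_of_nonpos_of_nonneg (neg_nonpos.2 (sq_nonneg _)) (by positivity)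
  simp_rw [Psi_standard, Psi, ← integral_mul_const]
  rw [integral_integral_swap hint]
  refine integral_congr_ae (Filter.Eventually.of_forall fun z ↦ ?_)
  simp_rw [hsq, integral_const_mul, hc]
  rw [← integral_const_mul, integral_normal_density hρ, mul_one]

lemma Icc_subset_of_ae {p q c e : ℝ} (hpq : p < q)
    (h : ∀ᵐ z : ℝ, z ∈ Icc p q → z ∈ Icc c e) : c ≤ p ∧ q ≤ e := by
  have hd := Measure.dense_of_ae h
  constructor
  · by_contra! hlt
    obtain ⟨z, hz, h1, h2⟩ := hd.exists_between (lt_min hpq hlt)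
    have := hz ⟨h1.le, (h2.trans_le (min_le_left _ _)).le⟩
    exact absurd this.1 (not_le.2 (h2.trans_le (min_le_right _ _)))
  · by_contra! hlt
    obtain ⟨z, hz, h1, h2⟩ := hd.exists_between (max_lt hpq hlt)
    have := hz ⟨((le_max_left _ _).trans_lt h1).le, h2.le⟩
    exact absurd this.2 (not_le.2 ((le_max_right _ _).trans_lt h1))

/-- Neyman–Pearson comparison of `[p, q]` with the superlevel set `[-τ, τ]` of `phi`. -/
lemma Psi_sub_le {τ p q : ℝ} (hτ : 0 < τ) (hpq : p < q) :
    Psi p q 0 1 - Psi (-τ) τ 0 1 ≤ phi τ * (q - p - 2 * τ) ∧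
      (Psi p q 0 1 - Psi (-τ) τ 0 1 = phi τ * (q - p - 2 * τ) → p = -τ ∧ q = τ) := by
  have hon : ∀ a b : ℝ, IntegrableOn (fun z ↦ phi τ - phi z) (Icc a b) := fun a b ↦
    (continuous_const.sub continuous_phi).integrableOn_Icc
  have hval : ∀ a b : ℝ, a ≤ b →
      ∫ z in Icc a b, (phi τ - phi z) = phi τ * (b - a) - Psi a b 0 1 := by
    intro a b hab
    rw [integral_sub (integrable_const _) integrable_phi.integrableOn, Psi_standard]
    simp [hab, mul_comm]
  set g : ℝ → ℝ := fun z ↦ (Icc p q).indicator (fun z ↦ phi τ - phi z) z -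
    (Icc (-τ) τ).indicator (fun z ↦ phi τ - phi z) z with hg
  have hgint : Integrable g :=
    ((hon p q).integrable_indicator measurableSet_Icc).sub
      ((hon _ _).integrable_indicator measurableSet_Icc)
  have hgval : ∫ z, g z = phi τ * (q - p - 2 * τ) - (Psi p q 0 1 - Psi (-τ) τ 0 1) := by
    rw [hg, integral_sub ((hon p q).integrable_indicator measurableSet_Icc)
      ((hon _ _).integrable_indicator measurableSet_Icc), integral_indicator measurableSet_Icc,
      integral_indicator measurableSet_Icc, hval p q hpq.le, hval (-τ) τ (by linarith)]
    ring
  have hmem : ∀ z, z ∈ Icc (-τ) τ ↔ phi τ ≤ phi z := by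
    intro z
    rw [phi_le_phi_iff, abs_of_pos hτ, abs_le, mem_Icc]
  have hg0 : 0 ≤ g := by
    intro z
    simp only [hg, indicator, hmem]
    split_ifs <;> simp <;> linarith
  refine ⟨?_, fun heq ↦ ?_⟩
  · have : 0 ≤ ∫ z, g z := integral_nonneg hg0
    linarith
  have hae : g =ᵐ[volume] 0 := (integral_eq_zero_iff_of_nonneg hg0 hgint).1 (by linarith)
  have hne : ∀ᵐ z : ℝ, z ≠ τ ∧ z ≠ -τ :=
    (Measure.ae_ne volume τ).and (Measure.ae_ne volume (-τ))
  have hiff : ∀ᵐ z : ℝ, (z ∈ Icc p q ↔ z ∈ Icc (-τ) τ) := by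
    filter_upwards [hae, hne] with z hz hz'
    have hzne : phi τ ≠ phi z := by
      intro h
      have := le_antisymm (phi_le_phi_iff.1 h.le) (phi_le_phi_iff.1 h.ge)
      rcases abs_eq_abs.1 this with h | h
      · exact hz'.1 h
      · exact hz'.2 h
    have hsub : phi τ - phi z ≠ 0 := sub_ne_zero.2 hzne
    have hz : (Icc p q).indicator (fun z ↦ phi τ - phi z) z -
      (Icc (-τ) τ).indicator (fun z ↦ phi τ - phi z) z = 0 := hz
    by_cases hA : z ∈ Icc p q <;> by_cases hB : z ∈ Icc (-τ) τ
    · exact iff_of_true hA hB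
    · rw [indicator_of_mem hA, indicator_of_notMem hB, sub_zero] at hz
      exact absurd hz hsub
    · rw [indicator_of_notMem hA, indicator_of_mem hB, zero_sub, neg_eq_zero] at hz
      exact absurd hz hsub
    · exact iff_of_false hA hB
  have h1 := Icc_subset_of_ae hpq (hiff.mono fun z hz ↦ hz.1)
  have h2 := Icc_subset_of_ae (show -τ < τ by linarith) (hiff.mono fun z hz ↦ hz.2)
  exact ⟨le_antisymm h2.1 h1.1, le_antisymm h1.2 h2.2⟩

lemma fW_pos {m : ℕ} (hm : 0 < m) {w : ℝ} (hw : 0 < w) : 0 < fW m w := by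
  have hm' : (0 : ℝ) < m := by exact_mod_cast hm
  have hΓ := Real.Gamma_pos_of_pos (half_pos hm')
  rw [fW, if_pos hw]
  positivity

lemma integrableOn_pow_mul_fW {m : ℕ} (hm : 0 < m) (k : ℕ) :
    IntegrableOn (fun w ↦ w ^ k * fW m w) (Ioi 0) := by
  have hm' : (1 : ℝ) ≤ m := by exact_mod_cast hm
  have hk : (0 : ℝ) ≤ k := k.cast_nonneg
  have := (integrableOn_rpow_mul_exp_neg_mul_sq (b := (m : ℝ) / 2) (by positivity)
    (s := k + ((m : ℝ) - 1)) (by linarith)).const_mul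
    (2 * ((m : ℝ) / 2) ^ ((m : ℝ) / 2) / Real.Gamma ((m : ℝ) / 2))
  refine IntegrableOn.congr_fun this (fun w hw ↦ ?_) measurableSet_Ioi
  have hw : 0 < w := hw
  simp only [fW, if_pos hw]
  rw [Real.rpow_add hw, Real.rpow_natCast]
  ring_nf

lemma integral_pow_mul_fW_pos {m : ℕ} (hm : 0 < m) (k : ℕ) :
    0 < ∫ w in Ioi 0, w ^ k * fW m w := by
  have hpos : ∀ w ∈ Ioi (0 : ℝ), 0 < w ^ k * fW m w := fun w hw ↦
    mul_pos (pow_pos hw k) (fW_pos hm hw)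
  rw [setIntegral_pos_iff_support_of_nonneg_ae
    ((ae_restrict_mem measurableSet_Ioi).mono fun w hw ↦ (hpos w hw).le)
    (integrableOn_pow_mul_fW hm k)]
  have : Function.support (fun w ↦ w ^ k * fW m w) ∩ Ioi 0 = Ioi 0 :=
    inter_eq_right.2 fun w hw ↦ (hpos w hw).ne'
  rw [this]
  simp

lemma EW_pos {m : ℕ} (hm : 0 < m) : 0 < EW m := by
  simpa [EW] using integral_pow_mul_fW_pos hm 1

lemma measurable_of_continuousAt_compl_finite {f : ℝ → ℝ} {S : Set ℝ} (hS : S.Finite)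
    (hf : ∀ x ∉ S, ContinuousAt f x) : Measurable f := by
  refine measurable_of_measurable_on_compl_finite S hS (Continuous.measurable ?_)
  exact continuousOn_iff_continuous_domRestrict.1 fun x hx ↦ (hf x hx).continuousWithinAt

lemma MemF.measurable_b {d t : ℝ} {b s : ℝ → ℝ} (h : MemF d t b s) : Measurable b := by
  obtain ⟨S, hS⟩ := h.b_cont
  exact measurable_of_continuousAt_compl_finite S.finite_toSet hS

lemma MemF.measurable_s_abs {d t : ℝ} {b s : ℝ → ℝ} (h : MemF d t b s) :
    Measurable fun x ↦ s |x| := by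
  obtain ⟨S, hS⟩ := h.s_cont
  have hfin : ((S : Set ℝ) ∪ Neg.neg '' (S : Set ℝ)).Finite :=
    S.finite_toSet.union (S.finite_toSet.image _)
  refine measurable_of_continuousAt_compl_finite hfin fun x hx ↦ ?_
  refine ContinuousAt.comp (g := s) (hS |x| (abs_nonneg x) fun hmem ↦ hx ?_)
    continuous_abs.continuousAt
  rcases abs_choice x with hx' | hx' <;> rw [hx'] at hmem
  · exact Or.inl hmem
  · exact Or.inr ⟨-x, hmem, neg_neg x⟩

/-- Integrating a normal scale-location mixture over the location `γ ∈ ℝ`, by Fubini. -/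
lemma integral_location_mixture {K : (ℝ × ℝ) × ℝ → ℝ} (hK : Measurable K) {M : ℝ}
    (hM : ∀ p, |K p| ≤ M) {c : ℝ → ℝ} (hc : IntegrableOn c (Ioi 0)) {d : ℝ} (hd : 0 < d) :
    ∫ γ, ∫ w in Ioi 0, (∫ x in (-d)..d, K ((w, x), γ) * phi (w * x - γ)) * c w =
      ∫ p, (∫ γ, K (p, γ) * phi (p.1 * p.2 - γ)) * c p.1
        ∂((volume.restrict (Ioi 0)).prod (volume.restrict (Ioc (-d) d))) := by
  set P := (volume.restrict (Ioi (0 : ℝ))).prod (volume.restrict (Ioc (-d) d)) with hP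
  have hcP : Integrable (fun p : ℝ × ℝ ↦ c p.1) P := hc.comp_fst _
  have hbase : Integrable (fun p : (ℝ × ℝ) × ℝ ↦ phi (p.1.1 * p.1.2 - p.2) * c p.1.1)
      (P.prod volume) := by
    have hcont : Continuous fun p : (ℝ × ℝ) × ℝ ↦ phi (p.1.1 * p.1.2 - p.2) :=
      continuous_phi.comp (by fun_prop)
    have hmeas : AEStronglyMeasurable (fun p : (ℝ × ℝ) × ℝ ↦ c p.1.1) (P.prod volume) :=
      AEStronglyMeasurable.comp_fst (f := fun p : ℝ × ℝ ↦ c p.1) hcP.1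
    have hmeas' : AEStronglyMeasurable (fun p : (ℝ × ℝ) × ℝ ↦
        phi (p.1.1 * p.1.2 - p.2) * c p.1.1) (P.prod volume) :=
      hcont.aestronglyMeasurable.mul hmeas
    rw [integrable_prod_iff hmeas']
    constructor
    · refine Filter.Eventually.of_forall fun p ↦ ?_
      have := integrable_phi.comp_sub_left (p.1 * p.2)
      exact this.mul_const (c p.1)
    · simp_rw [norm_mul, integral_mul_const, Real.norm_of_nonneg (phi_pos _).le]
      simp_rw [integral_sub_left_eq_self phi volume, integral_phi, one_mul]
      exact hcP.norm
  have hH : Integrable (fun p : (ℝ × ℝ) × ℝ ↦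
      K p * (phi (p.1.1 * p.1.2 - p.2) * c p.1.1)) (P.prod volume) :=
    hbase.bdd_mul hK.aestronglyMeasurable (Filter.Eventually.of_forall hM)
  calc _ = ∫ γ, ∫ p, K (p, γ) * (phi (p.1 * p.2 - γ) * c p.1) ∂P := by
        refine integral_congr_ae ?_
        filter_upwards [hH.prod_left_ae] with γ hγ
        rw [hP, integral_prod _ hγ]
        refine integral_congr_ae (Filter.Eventually.of_forall fun w ↦ ?_)
        simp only [intervalIntegral.integral_of_le (show -d ≤ d by linarith),
          ← integral_mul_const, mul_assoc]
    _ = ∫ p, (∫ γ, K (p, γ) * (phi (p.1 * p.2 - γ) * c p.1)) ∂P :=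
        (integral_integral_swap (f := fun (p : ℝ × ℝ) (γ : ℝ) ↦ K (p, γ) * (phi (p.1 * p.2 - γ) * c p.1)) hH).symm
    _ = _ := by simp only [← integral_mul_const, mul_assoc]

lemma measurable_Psi_shift {f g : ℝ → ℝ} (hf : Measurable f) (hg : Measurable g) (ρ v : ℝ) :
    Measurable fun p : (ℝ × ℝ) × ℝ ↦
      Psi (f p.1.2 * p.1.1) (g p.1.2 * p.1.1) (ρ * (p.1.1 * p.1.2 - p.2)) v := by
  have h1 : Measurable fun p : (ℝ × ℝ) × ℝ ↦ p.1.2 := measurable_snd.comp measurable_fst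
  have h2 : Measurable fun p : (ℝ × ℝ) × ℝ ↦ p.1.1 := measurable_fst.comp measurable_fst
  exact measurable_Psi ((hf.comp h1).mul h2) ((hg.comp h1).mul h2) (by fun_prop) v

lemma integrable_Psi_mul_phi {ρ : ℝ} (hρ : 0 < 1 - ρ ^ 2) (x y : ℝ) :
    Integrable fun u ↦ Psi x y (ρ * u) (1 - ρ ^ 2) * phi u := by
  refine integrable_phi.bdd_mul (c := 1) (measurable_Psi measurable_const measurable_const
    (by fun_prop) _).aestronglyMeasurable (Filter.Eventually.of_forall fun u ↦ ?_)
  rw [Real.norm_of_nonneg (Psi_nonneg _ _ _ _)]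
  exact Psi_le_one _ _ _ hρ

lemma abs_Psi_sub_Psi_le_one (x y x' y' μ μ' : ℝ) {v : ℝ} (hv : 0 < v) :
    |Psi x y μ v - Psi x' y' μ' v| ≤ 1 := by
  have h1 := Psi_nonneg x y μ v
  have h2 := Psi_nonneg x' y' μ' v
  have h3 := Psi_le_one x y μ hv
  have h4 := Psi_le_one x' y' μ' hv
  rw [abs_le]
  constructor <;> linarith

section admissibility

variable {m : ℕ} {t d ρ : ℝ} {b s : ℝ → ℝ}

lemma kfun_sub_kdag_of_pos {w : ℝ} (hw : 0 < w) (x γ : ℝ) :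
    kfun b s ρ (w * x) w γ - kdag t ρ (w * x) w γ =
      Psi ((b x - s |x|) * w) ((b x + s |x|) * w) (ρ * (w * x - γ)) (1 - ρ ^ 2) -
        Psi (-t * w) (t * w) (ρ * (w * x - γ)) (1 - ρ ^ 2) := by
  have hx : w * x / w = x := by field_simp
  have hx' : |w * x| / w = |x| := by
    rw [abs_mul, abs_of_pos hw]
    field_simp
  rw [kfun, kdag, hx, hx', sub_mul, add_mul, neg_mul]

lemma MemF.exists_abs_sub_le (h : MemF d t b s) : ∃ M, ∀ x, |s |x| - t| ≤ M := by
  obtain ⟨M, hM⟩ := h.s_bdd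
  refine ⟨M + |t|, fun x ↦ (abs_sub _ _).trans ?_⟩
  rw [abs_of_pos (h.s_pos _ (abs_nonneg x))]
  linarith [hM |x| (abs_nonneg x)]

lemma MemF.integrableOn_s_sub (h : MemF d t b s) :
    IntegrableOn (fun x ↦ s |x| - t) (Ioc (-d) d) := by
  obtain ⟨M, hM⟩ := h.exists_abs_sub_le
  exact Measure.integrableOn_of_bounded (M := M) (by simp)
    (h.measurable_s_abs.sub_const t).aestronglyMeasurable (Filter.Eventually.of_forall hM)

lemma MemF.integral_R1 (h : MemF d t b s) (hm : 0 < m) (hd : 0 < d) :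
    ∫ γ, R1 m t d s γ = (1 / (t * EW m)) *
      ((∫ w in Ioi 0, w ^ 2 * fW m w) * ∫ x in Ioc (-d) d, (s |x| - t)) := by
  obtain ⟨M, hM⟩ := h.exists_abs_sub_le
  have hK : Measurable fun p : (ℝ × ℝ) × ℝ ↦ s |p.1.2| - t :=
    (h.measurable_s_abs.comp (measurable_snd.comp measurable_fst)).sub_const t
  simp only [R1]
  rw [integral_const_mul, integral_location_mixture hK (fun p ↦ hM p.1.2)
    (integrableOn_pow_mul_fW hm 2) hd, ← integral_prod_mul]
  simp_rw [integral_const_mul, integral_sub_left_eq_self phi volume, integral_phi, mul_one,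
    mul_comm]

lemma MemF.integral_R2 (h : MemF d t b s) (hm : 0 < m) (hd : 0 < d) (hρ : 0 < 1 - ρ ^ 2) :
    ∫ γ, R2 m t d ρ b s γ =
      -∫ p, (Psi ((b p.2 - s |p.2|) * p.1) ((b p.2 + s |p.2|) * p.1) 0 1 -
          Psi (-t * p.1) (t * p.1) 0 1) * (p.1 * fW m p.1)
        ∂((volume.restrict (Ioi 0)).prod (volume.restrict (Ioc (-d) d))) := by
  have hK : Measurable fun p : (ℝ × ℝ) × ℝ ↦
      Psi ((b p.1.2 - s |p.1.2|) * p.1.1) ((b p.1.2 + s |p.1.2|) * p.1.1)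
        (ρ * (p.1.1 * p.1.2 - p.2)) (1 - ρ ^ 2) -
      Psi (-t * p.1.1) (t * p.1.1) (ρ * (p.1.1 * p.1.2 - p.2)) (1 - ρ ^ 2) :=
    (measurable_Psi_shift (h.measurable_b.sub h.measurable_s_abs)
      (h.measurable_b.add h.measurable_s_abs) ρ _).sub
      (measurable_Psi_shift (measurable_const (a := -t)) (measurable_const (a := t)) ρ _)
  have hc : IntegrableOn (fun w ↦ w * fW m w) (Ioi 0) := by
    simpa using integrableOn_pow_mul_fW hm 1
  have hmix := integral_location_mixture hK (fun p ↦ abs_Psi_sub_Psi_le_one _ _ _ _ _ _ hρ) hc hd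
  simp only [R2]
  rw [integral_neg]
  congr 1
  refine Eq.trans ?_ (hmix.trans ?_)
  · refine integral_congr_ae (Filter.Eventually.of_forall fun γ ↦ ?_)
    refine setIntegral_congr_fun measurableSet_Ioi fun w hw ↦ ?_
    simp only [kfun_sub_kdag_of_pos (mem_Ioi.1 hw)]
  · refine integral_congr_ae (Filter.Eventually.of_forall fun p ↦ ?_)
    simp only
    rw [integral_sub_left_eq_self (fun u ↦ (Psi ((b p.2 - s |p.2|) * p.1)
        ((b p.2 + s |p.2|) * p.1) (ρ * u) (1 - ρ ^ 2) -
      Psi (-t * p.1) (t * p.1) (ρ * u) (1 - ρ ^ 2)) * phi u) volume]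
    simp_rw [sub_mul (Psi _ _ _ _)]
    rw [integral_sub (integrable_Psi_mul_phi hρ _ _) (integrable_Psi_mul_phi hρ _ _),
      integral_Psi_mul_phi hρ, integral_Psi_mul_phi hρ, sub_mul (Psi _ _ _ _)]

/-- If both integrated risks are nonpositive, then the interval is the usual one almost
everywhere. -/
lemma MemF.ae_eq_usual (h : MemF d t b s) (hm : 0 < m) (ht : 0 < t) (hd : 0 < d)
    (hρ : 0 < 1 - ρ ^ 2) (h1 : ∫ γ, R1 m t d s γ ≤ 0) (h2 : ∫ γ, R2 m t d ρ b s γ ≤ 0) :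
    ∀ᵐ x ∂volume.restrict (Ioc (-d) d), b x = 0 ∧ s |x| = t := by
  have hEW := EW_pos hm
  have hS : ∫ x in Ioc (-d) d, (s |x| - t) ≤ 0 := by
    rw [h.integral_R1 hm hd] at h1
    have hC := integral_pow_mul_fW_pos hm 2
    by_contra! hlt
    have : 0 < 1 / (t * EW m) := by positivity
    exact absurd h1 (not_le.2 (by positivity))
  rw [h.integral_R2 hm hd hρ] at h2
  set P := (volume.restrict (Ioi (0 : ℝ))).prod (volume.restrict (Ioc (-d) d)) with hP
  set J : ℝ × ℝ → ℝ := fun p ↦ Psi ((b p.2 - s |p.2|) * p.1) ((b p.2 + s |p.2|) * p.1) 0 1 -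
    Psi (-t * p.1) (t * p.1) 0 1 with hJ
  have hJm : Measurable J := by
    refine Measurable.sub ?_ ?_ <;> refine measurable_Psi ?_ ?_ measurable_const _
    · exact ((h.measurable_b.sub h.measurable_s_abs).comp measurable_snd).mul measurable_fst
    · exact ((h.measurable_b.add h.measurable_s_abs).comp measurable_snd).mul measurable_fst
    all_goals fun_prop
  have hc : Integrable (fun w ↦ w * fW m w) (volume.restrict (Ioi 0)) := by
    simpa [IntegrableOn] using integrableOn_pow_mul_fW hm 1
  have hJint : Integrable (fun p ↦ J p * (p.1 * fW m p.1)) P :=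
    (hc.comp_fst _).bdd_mul (c := 1) hJm.aestronglyMeasurable
      (Filter.Eventually.of_forall fun p ↦ abs_Psi_sub_Psi_le_one _ _ _ _ _ _ one_pos)
  have hphi : Integrable (fun w ↦ phi (t * w) * (w ^ 2 * fW m w)) (volume.restrict (Ioi 0)) := by
    refine (integrableOn_pow_mul_fW hm 2).bdd_mul (c := phi 0)
      (continuous_phi.comp (by fun_prop)).aestronglyMeasurable
      (Filter.Eventually.of_forall fun w ↦ ?_)
    rw [Real.norm_of_nonneg (phi_pos _).le, phi_le_phi_iff, abs_zero]
    exact abs_nonneg _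
  have hLint : Integrable (fun p : ℝ × ℝ ↦
      phi (t * p.1) * (p.1 ^ 2 * fW m p.1) * (s |p.2| - t)) P :=
    hphi.mul_prod h.integrableOn_s_sub
  have hfst : ∀ᵐ p ∂P, 0 < p.1 :=
    Measure.quasiMeasurePreserving_fst.ae (ae_restrict_mem measurableSet_Ioi)
  have hcomp : ∀ p : ℝ × ℝ, 0 < p.1 → J p ≤ phi (t * p.1) * (2 * p.1 * (s |p.2| - t)) ∧
      (J p = phi (t * p.1) * (2 * p.1 * (s |p.2| - t)) → b p.2 = 0 ∧ s |p.2| = t) := by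
    rintro ⟨w, x⟩ hw
    have hw : 0 < w := hw
    have hsx := h.s_pos |x| (abs_nonneg x)
    have hlt : (b x - s |x|) * w < (b x + s |x|) * w :=
      mul_lt_mul_of_pos_right (by linarith) hw
    have key := Psi_sub_le (mul_pos ht hw) hlt
    have hlen : (b x + s |x|) * w - (b x - s |x|) * w - 2 * (t * w) =
        2 * w * (s |x| - t) := by ring
    rw [hlen, ← neg_mul] at key
    refine ⟨key.1, fun heq ↦ ?_⟩
    obtain ⟨e1, e2⟩ := key.2 heq
    have e1 := mul_right_cancel₀ hw.ne' e1
    have e2 := mul_right_cancel₀ hw.ne' e2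
    constructor <;> simp only <;> linarith
  set D : ℝ × ℝ → ℝ := fun p ↦ 2 * (phi (t * p.1) * (p.1 ^ 2 * fW m p.1) * (s |p.2| - t)) -
    J p * (p.1 * fW m p.1) with hD
  have hDeq : ∀ p, D p =
      (phi (t * p.1) * (2 * p.1 * (s |p.2| - t)) - J p) * (p.1 * fW m p.1) := fun p ↦ by
    simp only [hD]
    ring
  have hDint : Integrable D P := (hLint.const_mul 2).sub hJint
  have hD0 : 0 ≤ᵐ[P] D := by
    filter_upwards [hfst] with p hp
    rw [hDeq]
    exact mul_nonneg (sub_nonneg.2 (hcomp p hp).1) (mul_pos hp (fW_pos hm hp)).le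
  have hDle : ∫ p, D p ∂P ≤ 0 := by
    rw [hD, integral_sub (hLint.const_mul 2) hJint, integral_const_mul, hP,
      integral_prod_mul (fun w ↦ phi (t * w) * (w ^ 2 * fW m w)) (fun x ↦ s |x| - t), ← hP]
    have hnn : 0 ≤ ∫ w in Ioi 0, phi (t * w) * (w ^ 2 * fW m w) :=
      setIntegral_nonneg measurableSet_Ioi fun w hw ↦
        mul_nonneg (phi_pos _).le (mul_nonneg (sq_nonneg _) (fW_pos hm hw).le)
    linarith [mul_nonpos_of_nonneg_of_nonpos hnn hS]
  have hDae : ∀ᵐ p ∂P, b p.2 = 0 ∧ s |p.2| = t := by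
    have := (integral_eq_zero_iff_of_nonneg_ae hD0 hDint).1
      (le_antisymm hDle (integral_nonneg_of_ae hD0))
    filter_upwards [this, hfst] with p hp hp0
    rw [hDeq, Pi.zero_apply, mul_eq_zero,
      or_iff_left (mul_pos hp0 (fW_pos hm hp0)).ne'] at hp
    exact (hcomp p hp0).2 (sub_eq_zero.1 hp).symm
  have hw := Measure.ae_ae_of_ae_prod hDae
  have : (volume.restrict (Ioi (0 : ℝ))) ≠ 0 := by simp [Measure.restrict_eq_zero]
  have : (ae (volume.restrict (Ioi (0 : ℝ)))).NeBot := ae_neBot.2 this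
  exact hw.exists.choose_spec

lemma R1_eq_zero (hd : 0 < d) (h : ∀ᵐ x ∂volume.restrict (Ioc (-d) d), b x = 0 ∧ s |x| = t)
    (γ : ℝ) : R1 m t d s γ = 0 := by
  have hin : ∀ w : ℝ, ∫ x in (-d)..d, (s |x| - t) * phi (w * x - γ) = 0 := fun w ↦ by
    rw [intervalIntegral.integral_of_le (by linarith)]
    refine integral_eq_zero_of_ae ?_
    filter_upwards [h] with x hx
    simp [hx.2]
  simp [R1, hin]

lemma R2_eq_zero (hd : 0 < d) (h : ∀ᵐ x ∂volume.restrict (Ioc (-d) d), b x = 0 ∧ s |x| = t)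
    (γ : ℝ) : R2 m t d ρ b s γ = 0 := by
  rw [R2, neg_eq_zero]
  refine setIntegral_eq_zero_of_forall_eq_zero fun w hw ↦ ?_
  rw [intervalIntegral.integral_of_le (by linarith)]
  refine mul_eq_zero_of_left (integral_eq_zero_of_ae ?_) _
  filter_upwards [h] with x hx
  simp [kfun_sub_kdag_of_pos (mem_Ioi.1 hw), hx.1, hx.2]

end admissibility

/-- **Theorem 1 (reduced form).** There is no `(b,s) ∈ F(d)` whose confidence interval
`J(b,s)` has expected length everywhere no larger than that of the usual interval `I`
(`R1 ≤ 0`), coverage probability everywhere no smaller (`R2 ≤ 0`), and strict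
improvement in one of the two criteria somewhere: the usual interval is strongly
admissible within the class `D`. -/
theorem usual_interval_strongly_admissible
    (m : ℕ) (hm : 0 < m) (t d ρ : ℝ) (ht : 0 < t) (hd : 0 < d)
    (hρ₁ : -1 < ρ) (hρ₂ : ρ < 1) :
    ¬∃ b s : ℝ → ℝ, MemF d t b s ∧
      (∀ γ : ℝ, R1 m t d s γ ≤ 0) ∧
      (∀ γ : ℝ, R2 m t d ρ b s γ ≤ 0) ∧
      ((∃ γ : ℝ, R1 m t d s γ < 0) ∨ (∃ γ : ℝ, R2 m t d ρ b s γ < 0)) := by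
  rintro ⟨b, s, hF, h1, h2, h3⟩
  have hρ : 0 < 1 - ρ ^ 2 := by nlinarith
  have hae := hF.ae_eq_usual hm ht hd hρ (integral_nonpos h1) (integral_nonpos h2)
  rcases h3 with ⟨γ, hγ⟩ | ⟨γ, hγ⟩
  · exact hγ.ne (R1_eq_zero hd hae γ)
  · exact hγ.ne (R2_eq_zero hd hae γ)
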